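/- arXiv:1903.01457 — 7 statements merged into one kernel-verified Lean document; each statement's English description precedes it below -/
import Mathlib

section
/- The function ψ is continuously differentiable on all of ℝ (in particular ψ is differentiable at 0 with ψ(0) = 1 and ψ′(0) = λ₁ = √(2r)/σ₁), and ψ satisfies the ordinary differential equation (σ₁²/2)·ψ″(x) = r·ψ(x) for every x < 0 and (σ₂²/2)·ψ″(x) = r·ψ(x) for every x > 0. -/
open Real Filter Set

/-- The increasing fundamental solution ψ for the oscillating Brownian motion with
volatility `σ₁` on `(-∞,0)` and `σ₂` on `(0,∞)`, discount parameter `r`. -/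
noncomputable def psi (σ₁ σ₂ r x : ℝ) : ℝ :=
  if x < 0 then Real.exp (Real.sqrt (2*r)/σ₁ * x)
  else (1 + σ₂/σ₁)/2 * Real.exp (Real.sqrt (2*r)/σ₂ * x)
     + (1 - σ₂/σ₁)/2 * Real.exp (-(Real.sqrt (2*r)/σ₂) * x)

/-- Two differentiable functions whose values and derivatives agree at `a` glue at `a` to a
differentiable function. -/
theorem hasDerivAt_ite_lt {f g f' g' : ℝ → ℝ} {a : ℝ}
    (hf : ∀ x, HasDerivAt f (f' x) x) (hg : ∀ x, HasDerivAt g (g' x) x)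
    (hfg : f a = g a) (hfg' : f' a = g' a) (x : ℝ) :
    HasDerivAt (fun y => if y < a then f y else g y) (if x < a then f' x else g' x) x := by
  rcases lt_trichotomy x a with hx | rfl | hx
  · rw [if_pos hx]
    refine (hf x).congr_of_eventuallyEq ?_
    filter_upwards [Iio_mem_nhds hx] with y hy
    exact if_pos hy
  · rw [if_neg (lt_irrefl x), ← hasDerivWithinAt_univ, ← Iic_union_Ici (a := x)]
    refine HasDerivWithinAt.union ?_ ?_
    · rw [← hfg']
      refine (hf x).hasDerivWithinAt.congr (fun y hy => ?_) (by simp [hfg])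
      rcases (mem_Iic.1 hy).lt_or_eq with h | rfl
      · exact if_pos h
      · simp [hfg]
    · exact (hg x).hasDerivWithinAt.congr (fun y hy => if_neg (not_lt.2 hy)) (by simp)
  · rw [if_neg hx.le.not_gt]
    refine (hg x).congr_of_eventuallyEq ?_
    filter_upwards [Ioi_mem_nhds hx] with y hy
    exact if_neg (not_lt.2 (le_of_lt hy))

theorem hasDerivAt_const_mul_exp (c l x : ℝ) :
    HasDerivAt (fun y => c * Real.exp (l * y)) (c * l * Real.exp (l * x)) x := by
  refine (((hasDerivAt_id x).const_mul l).exp.const_mul c).congr_deriv ?_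
  simp only [id]
  ring

/-- The derivative of `psi`. -/
theorem hasDerivAt_psi {σ₁ σ₂ : ℝ} (r : ℝ) (hσ₁ : 0 < σ₁) (hσ₂ : 0 < σ₂) (x : ℝ) :
    HasDerivAt (psi σ₁ σ₂ r)
      (if x < 0 then Real.sqrt (2*r)/σ₁ * Real.exp (Real.sqrt (2*r)/σ₁ * x)
        else (1 + σ₂/σ₁)/2 * (Real.sqrt (2*r)/σ₂) * Real.exp (Real.sqrt (2*r)/σ₂ * x)
          + (1 - σ₂/σ₁)/2 * (-(Real.sqrt (2*r)/σ₂))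
            * Real.exp (-(Real.sqrt (2*r)/σ₂) * x)) x := by
  refine hasDerivAt_ite_lt (a := 0)
    (f' := fun x => Real.sqrt (2*r)/σ₁ * Real.exp (Real.sqrt (2*r)/σ₁ * x))
    (g' := fun x => (1 + σ₂/σ₁)/2 * (Real.sqrt (2*r)/σ₂) * Real.exp (Real.sqrt (2*r)/σ₂ * x)
          + (1 - σ₂/σ₁)/2 * (-(Real.sqrt (2*r)/σ₂))
            * Real.exp (-(Real.sqrt (2*r)/σ₂) * x))
    (fun y => ?_)
    (fun y => (hasDerivAt_const_mul_exp _ _ y).add (hasDerivAt_const_mul_exp _ _ y)) ?_ ?_ x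
  · simpa using hasDerivAt_const_mul_exp 1 (Real.sqrt (2*r)/σ₁) y
  · simp only [Pi.add_apply, mul_zero, Real.exp_zero]
    ring
  · simp only [mul_zero, Real.exp_zero]
    field_simp
    ring

/-- ψ is C¹ on ℝ (in particular ψ(0)=1 and ψ′(0)=√(2r)/σ₁), and ψ satisfies
(σᵢ²/2)·ψ″ = r·ψ on each half-line. -/
theorem stmt_0 (σ₁ σ₂ r : ℝ) (hσ₁ : 0 < σ₁) (hσ₂ : 0 < σ₂) (hr : 0 < r) :
    ContDiff ℝ 1 (psi σ₁ σ₂ r) ∧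
    psi σ₁ σ₂ r 0 = 1 ∧
    deriv (psi σ₁ σ₂ r) 0 = Real.sqrt (2*r)/σ₁ ∧
    (∀ x < (0:ℝ), σ₁^2/2 * deriv (deriv (psi σ₁ σ₂ r)) x = r * psi σ₁ σ₂ r x) ∧
    (∀ x > (0:ℝ), σ₂^2/2 * deriv (deriv (psi σ₁ σ₂ r)) x = r * psi σ₁ σ₂ r x) := by
  have hd := hasDerivAt_psi (σ₁ := σ₁) (σ₂ := σ₂) r hσ₁ hσ₂
  have hd' := funext fun x => (hd x).deriv
  have hs : Real.sqrt (2*r) ^ 2 = 2 * r := Real.sq_sqrt (by positivity)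
  have h0 : deriv (psi σ₁ σ₂ r) 0 = Real.sqrt (2*r)/σ₁ := by
    simp only [hd', lt_irrefl, if_false, mul_zero, Real.exp_zero]
    field_simp
    ring
  refine ⟨contDiff_one_iff_deriv.2 ⟨fun x => (hd x).differentiableAt, ?_⟩, ?_, h0, ?_, ?_⟩
  · rw [hd']
    refine Continuous.if (fun a ha => ?_) (by fun_prop) (by fun_prop)
    obtain rfl : a = 0 := frontier_lt_subset_eq continuous_id continuous_const ha
    simp only [mul_zero, Real.exp_zero]
    field_simp
    ring
  · simp only [psi, lt_irrefl, if_false, mul_zero, Real.exp_zero]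
    ring
  · intro x hx
    have h : deriv (psi σ₁ σ₂ r) =ᶠ[nhds x]
        fun y => Real.sqrt (2*r)/σ₁ * Real.exp (Real.sqrt (2*r)/σ₁ * y) := by
      filter_upwards [Iio_mem_nhds hx] with y hy
      rw [hd']
      exact if_pos hy
    rw [h.deriv_eq, (hasDerivAt_const_mul_exp _ _ x).deriv, psi, if_pos hx]
    have hc : Real.sqrt (2*r)/σ₁ * (Real.sqrt (2*r)/σ₁) = 2 * r / σ₁ ^ 2 := by
      rw [← sq, div_pow, hs]
    rw [hc]
    field_simp
  · intro x hx
    have h : deriv (psi σ₁ σ₂ r) =ᶠ[nhds x]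
        fun y => (1 + σ₂/σ₁)/2 * (Real.sqrt (2*r)/σ₂) * Real.exp (Real.sqrt (2*r)/σ₂ * y)
          + (1 - σ₂/σ₁)/2 * (-(Real.sqrt (2*r)/σ₂))
            * Real.exp (-(Real.sqrt (2*r)/σ₂) * y) := by
      filter_upwards [Ioi_mem_nhds hx] with y hy
      rw [hd']
      exact if_neg (not_lt.2 (le_of_lt hy))
    have h2 := ((hasDerivAt_const_mul_exp ((1 + σ₂/σ₁)/2 * (Real.sqrt (2*r)/σ₂))
      (Real.sqrt (2*r)/σ₂) x).add (hasDerivAt_const_mul_exp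
      ((1 - σ₂/σ₁)/2 * (-(Real.sqrt (2*r)/σ₂))) (-(Real.sqrt (2*r)/σ₂)) x)).deriv
    have hc : σ₂ ^ 2 / 2 * (Real.sqrt (2*r)/σ₂) ^ 2 = r := by
      rw [div_pow, hs]
      field_simp
    rw [h.deriv_eq, psi, if_neg (not_lt.2 (le_of_lt hx))]
    refine (congrArg (σ₂ ^ 2 / 2 * ·) h2).trans ?_
    linear_combination ((1 + σ₂/σ₁)/2 * Real.exp (Real.sqrt (2*r)/σ₂ * x)
      + (1 - σ₂/σ₁)/2 * Real.exp (-(Real.sqrt (2*r)/σ₂) * x)) * hc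
end

section
/- The function ψ is strictly positive on ℝ, strictly increasing on ℝ, ψ(x) → 0 as x → −∞, and ψ(x) → +∞ as x → +∞. -/
open Real Filter Set

lemma psi_of_neg (σ₁ σ₂ r : ℝ) {x : ℝ} (hx : x < 0) :
    psi σ₁ σ₂ r x = Real.exp (Real.sqrt (2 * r) / σ₁ * x) :=
  if_pos hx

/-- On the nonnegative half-line, ψ is a combination of hyperbolic functions. -/
lemma psi_of_nonneg (σ₁ σ₂ r : ℝ) {x : ℝ} (hx : 0 ≤ x) :
    psi σ₁ σ₂ r x = Real.cosh (Real.sqrt (2 * r) / σ₂ * x)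
      + σ₂ / σ₁ * Real.sinh (Real.sqrt (2 * r) / σ₂ * x) := by
  rw [psi, if_neg hx.not_gt, Real.cosh_eq, Real.sinh_eq, neg_mul]
  ring

/-- ψ is strictly positive, strictly increasing, ψ(x)→0 as x→−∞, ψ(x)→+∞ as x→+∞. -/
theorem stmt_1 (σ₁ σ₂ r : ℝ) (hσ₁ : 0 < σ₁) (hσ₂ : 0 < σ₂) (hr : 0 < r) :
    (∀ x : ℝ, 0 < psi σ₁ σ₂ r x) ∧
    StrictMono (psi σ₁ σ₂ r) ∧
    Tendsto (psi σ₁ σ₂ r) atBot (nhds 0) ∧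
    Tendsto (psi σ₁ σ₂ r) atTop atTop := by
  have hs : 0 < Real.sqrt (2 * r) := Real.sqrt_pos.2 (by positivity)
  have h₁ : 0 < Real.sqrt (2 * r) / σ₁ := div_pos hs hσ₁
  have h₂ : 0 < Real.sqrt (2 * r) / σ₂ := div_pos hs hσ₂
  have hq : 0 < σ₂ / σ₁ := div_pos hσ₂ hσ₁
  have one_le {x : ℝ} (hx : 0 ≤ x) : 1 ≤ psi σ₁ σ₂ r x := by
    rw [psi_of_nonneg _ _ _ hx]
    have := mul_nonneg hq.le (Real.sinh_nonneg_iff.2 (mul_nonneg h₂.le hx))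
    linarith [Real.one_le_cosh (Real.sqrt (2 * r) / σ₂ * x)]
  refine ⟨fun x => ?_, fun x y hxy => ?_, ?_, ?_⟩
  · rcases lt_or_ge x 0 with hx | hx
    · rw [psi_of_neg _ _ _ hx]
      exact Real.exp_pos _
    · exact one_pos.trans_le (one_le hx)
  · rcases lt_or_ge y 0 with hy | hy
    · rw [psi_of_neg _ _ _ hy, psi_of_neg _ _ _ (hxy.trans hy)]
      exact Real.exp_lt_exp.2 (mul_lt_mul_of_pos_left hxy h₁)
    · rcases lt_or_ge x 0 with hx | hx
      · rw [psi_of_neg _ _ _ hx]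
        exact (Real.exp_lt_one_iff.2 (mul_neg_of_pos_of_neg h₁ hx)).trans_le (one_le hy)
      · rw [psi_of_nonneg _ _ _ hx, psi_of_nonneg _ _ _ hy]
        have hlt := mul_lt_mul_of_pos_left hxy h₂
        have hx' := mul_nonneg h₂.le hx
        have hy' := mul_nonneg h₂.le hy
        refine add_lt_add (Real.cosh_lt_cosh.2 ?_)
          (mul_lt_mul_of_pos_left (Real.sinh_lt_sinh.2 hlt) hq)
        rwa [abs_of_nonneg hx', abs_of_nonneg hy']
  · have hlim : Tendsto (fun x => Real.exp (Real.sqrt (2 * r) / σ₁ * x)) atBot (nhds 0) :=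
      Real.tendsto_exp_atBot.comp (tendsto_id.const_mul_atBot h₁)
    refine hlim.congr' ?_
    filter_upwards [eventually_lt_atBot 0] with x hx
    exact (psi_of_neg _ _ _ hx).symm
  · have hlim : Tendsto (fun x => σ₂ / σ₁ * (Real.sqrt (2 * r) / σ₂ * x)) atTop atTop :=
      (tendsto_id.const_mul_atTop h₂).const_mul_atTop hq
    refine tendsto_atTop_mono' _ ?_ hlim
    filter_upwards [eventually_ge_atTop 0] with x hx
    rw [psi_of_nonneg _ _ _ hx]
    have := mul_le_mul_of_nonneg_left
      (Real.self_le_sinh_iff.2 (mul_nonneg h₂.le hx)) hq.le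
    linarith [Real.cosh_pos (Real.sqrt (2 * r) / σ₂ * x)]
end

section
/- For every x with x > −1 and x ≠ 0, the function H is differentiable at x with derivative H′(x) = (2r/σ(x)²)·ψ(x)·(1+x), where σ(x) = σ₁ for x < 0 and σ(x) = σ₂ for x > 0; in particular H′(x) > 0 for all such x. -/
open Real Filter Set

/-- H(x) = ψ′(x)·(1+x) − ψ(x). -/
noncomputable def Hfun (σ₁ σ₂ r x : ℝ) : ℝ :=
  deriv (psi σ₁ σ₂ r) x * (1 + x) - psi σ₁ σ₂ r x

theorem hasDerivAt_exp_combination (A B a x : ℝ) :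
    HasDerivAt (fun y => A * Real.exp (a * y) + B * Real.exp (-a * y))
      (a * (A * Real.exp (a * x) - B * Real.exp (-a * x))) x := by
  have h (c : ℝ) : HasDerivAt (fun y => Real.exp (c * y)) (Real.exp (c * x) * (c * 1)) x :=
    ((hasDerivAt_id x).const_mul c).exp
  exact (((h a).const_mul A).add ((h (-a)).const_mul B)).congr_deriv (by ring)

/-- Where `ψ` is locally a combination of `exp (± a x)`, `H` has derivative `a² ψ(x) (1 + x)`. -/
theorem hasDerivAt_Hfun_of_eventuallyEq {σ₁ σ₂ r A B a x : ℝ}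
    (h : psi σ₁ σ₂ r =ᶠ[nhds x] fun y => A * Real.exp (a * y) + B * Real.exp (-a * y)) :
    HasDerivAt (Hfun σ₁ σ₂ r) (a ^ 2 * psi σ₁ σ₂ r x * (1 + x)) x := by
  have hpsi := (hasDerivAt_exp_combination A B a x).congr_of_eventuallyEq h
  have hderiv : deriv (psi σ₁ σ₂ r) =ᶠ[nhds x]
      fun y => (a * A) * Real.exp (a * y) + (-(a * B)) * Real.exp (-a * y) := by
    filter_upwards [h.deriv] with y hy
    rw [hy, (hasDerivAt_exp_combination A B a y).deriv]
    ring
  have hpsi' := (hasDerivAt_exp_combination (a * A) (-(a * B)) a x).congr_of_eventuallyEq hderiv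
  refine ((hpsi'.mul ((hasDerivAt_id x).const_add 1)).sub hpsi).congr_deriv ?_
  rw [hderiv.eq_of_nhds, h.eq_of_nhds]
  simp only [id]
  ring

theorem psi_pos {σ₁ σ₂ r : ℝ} (hσ₁ : 0 < σ₁) (hσ₂ : 0 < σ₂) (x : ℝ) :
    0 < psi σ₁ σ₂ r x := by
  unfold psi
  split_ifs with hx
  · positivity
  · have hle : Real.exp (-(Real.sqrt (2*r)/σ₂) * x) ≤ Real.exp (Real.sqrt (2*r)/σ₂ * x) := by
      have : 0 ≤ Real.sqrt (2*r)/σ₂ * x := mul_nonneg (by positivity) (not_lt.mp hx)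
      exact Real.exp_le_exp.mpr (by linarith)
    have hmul := mul_nonneg (div_pos hσ₂ hσ₁).le (sub_nonneg.mpr hle)
    linarith [Real.exp_pos (-(Real.sqrt (2*r)/σ₂) * x), Real.exp_pos (Real.sqrt (2*r)/σ₂ * x)]

/-- For x > −1, x ≠ 0, H is differentiable at x with
H′(x) = (2r/σ(x)²)·ψ(x)·(1+x) > 0, where σ(x)=σ₁ for x<0 and σ(x)=σ₂ for x>0. -/
theorem stmt_3 (σ₁ σ₂ r : ℝ) (hσ₁ : 0 < σ₁) (hσ₂ : 0 < σ₂) (hr : 0 < r) :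
    ∀ x : ℝ, -1 < x → x ≠ 0 →
      HasDerivAt (Hfun σ₁ σ₂ r)
        (2*r/(if x < 0 then σ₁ else σ₂)^2 * psi σ₁ σ₂ r x * (1 + x)) x ∧
      0 < 2*r/(if x < 0 then σ₁ else σ₂)^2 * psi σ₁ σ₂ r x * (1 + x) := by
  intro x hx hx0
  have hsq (σ : ℝ) : (Real.sqrt (2*r)/σ)^2 = 2*r/σ^2 := by
    rw [div_pow, Real.sq_sqrt (by positivity)]
  have hpos := psi_pos (r := r) hσ₁ hσ₂ x
  have hx1 : 0 < 1 + x := by linarith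
  rcases lt_or_gt_of_ne hx0 with hneg | hgt
  · rw [if_pos hneg]
    refine ⟨?_, by positivity⟩
    rw [← hsq]
    apply hasDerivAt_Hfun_of_eventuallyEq (A := 1) (B := 0)
    filter_upwards [Iio_mem_nhds hneg] with y hy
    simp [psi, mem_Iio.mp hy]
  · rw [if_neg hgt.not_gt]
    refine ⟨?_, by positivity⟩
    rw [← hsq]
    apply hasDerivAt_Hfun_of_eventuallyEq (A := (1 + σ₂/σ₁)/2) (B := (1 - σ₂/σ₁)/2)
    filter_upwards [Ioi_mem_nhds hgt] with y hy
    exact if_neg (mem_Ioi.mp hy).not_gt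
end

section
/- Let c ∈ (−1,∞) be the unique zero of H. Then the function x ↦ ψ(x)/(1+x) is strictly decreasing on the interval (−1, c); in particular, for every x with −1 < x < c one has ψ(x)/(1+x) ≥ ψ(c)/(1+c), i.e. ψ(x)·(1+c) ≥ ψ(c)·(1+x). -/
open Real Filter Set

/-- The derivative of `psi`. -/
noncomputable def psiDeriv (σ₁ σ₂ r x : ℝ) : ℝ :=
  if x < 0 then √(2 * r) / σ₁ * Real.exp (√(2 * r) / σ₁ * x)
  else √(2 * r) / σ₂ * ((1 + σ₂ / σ₁) / 2 * Real.exp (√(2 * r) / σ₂ * x)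
     - (1 - σ₂ / σ₁) / 2 * Real.exp (-(√(2 * r) / σ₂) * x))

theorem continuous_ite_neg {f g : ℝ → ℝ} (hf : Continuous f) (hg : Continuous g)
    (h : f 0 = g 0) : Continuous fun x => if x < 0 then f x else g x := by
  have hgf : Continuous fun x => if 0 ≤ x then g x else f x :=
    hg.if_le hf continuous_const continuous_id fun x hx => by rw [← hx]; exact h.symm
  refine hgf.congr fun x => ?_
  by_cases hx : x < 0
  · simp [hx, not_le.2 hx]
  · simp [hx, not_lt.1 hx]

theorem psi_continuous (σ₁ σ₂ r : ℝ) : Continuous (psi σ₁ σ₂ r) := by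
  refine continuous_ite_neg (by fun_prop) (by fun_prop) ?_
  simp only [mul_zero, Real.exp_zero]
  ring

theorem psiDeriv_continuous (σ₁ σ₂ r : ℝ) (hσ₁ : 0 < σ₁) (hσ₂ : 0 < σ₂) :
    Continuous (psiDeriv σ₁ σ₂ r) := by
  refine continuous_ite_neg (by fun_prop) (by fun_prop) ?_
  simp only [mul_zero, Real.exp_zero]
  field_simp
  ring

theorem hasDerivAt_exp_const_mul (a x : ℝ) :
    HasDerivAt (fun y => Real.exp (a * y)) (a * Real.exp (a * x)) x := by
  simpa [mul_comm] using ((hasDerivAt_id' x).const_mul a).exp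

theorem psi_hasDerivAt_of_ne_zero (σ₁ σ₂ r : ℝ) {x : ℝ} (hx : x ≠ 0) :
    HasDerivAt (psi σ₁ σ₂ r) (psiDeriv σ₁ σ₂ r x) x := by
  rcases hx.lt_or_gt with hx | hx
  · rw [psiDeriv, if_pos hx]
    refine (hasDerivAt_exp_const_mul _ x).congr_of_eventuallyEq ?_
    filter_upwards [Iio_mem_nhds hx] with y hy
    exact if_pos hy
  · rw [psiDeriv, if_neg hx.not_gt]
    have h := ((hasDerivAt_exp_const_mul (√(2 * r) / σ₂) x).const_mul ((1 + σ₂ / σ₁) / 2)).fun_add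
      ((hasDerivAt_exp_const_mul (-(√(2 * r) / σ₂)) x).const_mul ((1 - σ₂ / σ₁) / 2))
    refine (h.congr_of_eventuallyEq ?_).congr_deriv (by ring)
    filter_upwards [Ioi_mem_nhds hx] with y hy
    exact if_neg (not_lt.2 (le_of_lt (mem_Ioi.1 hy)))

theorem psi_hasDerivAt (σ₁ σ₂ r : ℝ) (hσ₁ : 0 < σ₁) (hσ₂ : 0 < σ₂) (x : ℝ) :
    HasDerivAt (psi σ₁ σ₂ r) (psiDeriv σ₁ σ₂ r x) x :=
  hasDerivAt_of_hasDerivAt_of_ne' (fun _ hy => psi_hasDerivAt_of_ne_zero σ₁ σ₂ r hy)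
    (psi_continuous σ₁ σ₂ r).continuousAt (psiDeriv_continuous σ₁ σ₂ r hσ₁ hσ₂).continuousAt x

theorem Hfun_continuous (σ₁ σ₂ r : ℝ) (hσ₁ : 0 < σ₁) (hσ₂ : 0 < σ₂) :
    Continuous (Hfun σ₁ σ₂ r) := by
  have hderiv : deriv (psi σ₁ σ₂ r) = psiDeriv σ₁ σ₂ r :=
    deriv_eq (psi_hasDerivAt σ₁ σ₂ r hσ₁ hσ₂)
  have hψ := psi_continuous σ₁ σ₂ r
  have hψ' := psiDeriv_continuous σ₁ σ₂ r hσ₁ hσ₂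
  unfold Hfun
  rw [hderiv]
  fun_prop

theorem Hfun_neg_one (σ₁ σ₂ r : ℝ) : Hfun σ₁ σ₂ r (-1) < 0 := by
  simp [Hfun, psi, Real.exp_pos]

/-- If c ∈ (−1,∞) is the unique zero of H, then x ↦ ψ(x)/(1+x) is strictly
decreasing on (−1,c); in particular ψ(x)·(1+c) ≥ ψ(c)·(1+x) for −1 < x < c. -/
theorem stmt_6 (σ₁ σ₂ r : ℝ) (hσ₁ : 0 < σ₁) (hσ₂ : 0 < σ₂) (hr : 0 < r)
    (c : ℝ) (hc : -1 < c) (hc0 : Hfun σ₁ σ₂ r c = 0)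
    (huniq : ∀ y : ℝ, -1 < y → Hfun σ₁ σ₂ r y = 0 → y = c) :
    StrictAntiOn (fun x => psi σ₁ σ₂ r x / (1 + x)) (Set.Ioo (-1) c) ∧
    (∀ x : ℝ, -1 < x → x < c →
      psi σ₁ σ₂ r c / (1 + c) ≤ psi σ₁ σ₂ r x / (1 + x) ∧
      psi σ₁ σ₂ r c * (1 + x) ≤ psi σ₁ σ₂ r x * (1 + c)) := by
  have hψ := psi_hasDerivAt σ₁ σ₂ r hσ₁ hσ₂
  have hneg : ∀ x ∈ Ioo (-1) c, Hfun σ₁ σ₂ r x < 0 := by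
    intro x hx
    by_contra! hge
    have hivt := intermediate_value_Icc hx.1.le (Hfun_continuous σ₁ σ₂ r hσ₁ hσ₂).continuousOn
    obtain ⟨y, hy, hy0⟩ := hivt ⟨(Hfun_neg_one σ₁ σ₂ r).le, hge⟩
    have hy1 : -1 < y := by
      refine lt_of_le_of_ne hy.1 fun h => ?_
      subst h
      exact (Hfun_neg_one σ₁ σ₂ r).ne hy0
    linarith [huniq y hy1 hy0, hy.2, hx.2]
  have hanti : StrictAntiOn (fun x => psi σ₁ σ₂ r x / (1 + x)) (Ioc (-1) c) := by
    refine strictAntiOn_of_deriv_neg (convex_Ioc _ _) ?_ ?_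
    · refine (psi_continuous σ₁ σ₂ r).continuousOn.div (by fun_prop) fun x hx => ?_
      linarith [hx.1]
    · intro x hx
      rw [interior_Ioc] at hx
      have hx1 : 0 < 1 + x := by linarith [hx.1]
      have h := (hψ x).fun_div ((hasDerivAt_id' x).const_add 1) hx1.ne'
      rw [h.deriv, mul_one]
      refine div_neg_of_neg_of_pos ?_ (by positivity)
      have hH := hneg x hx
      rwa [Hfun, (hψ x).deriv] at hH
  refine ⟨hanti.mono Ioo_subset_Ioc_self, fun x hx hxc => ?_⟩
  have hle := (hanti ⟨hx, hxc.le⟩ ⟨hc, le_rfl⟩ hxc).le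
  exact ⟨hle, (div_le_div_iff₀ (by linarith) (by linarith)).1 hle⟩
end

section
/- For every x with x > −1 and x ≠ 0, the function G is differentiable at x with derivative G′(x) = (2/σ(x)²)·ψ(x)·(r(1+x)² − σ(x)²), where σ(x) = σ₁ for x < 0 and σ(x) = σ₂ for x > 0. -/
open Real Filter Set

/-- G(x) = ψ′(x)·(1+x)² − 2·ψ(x)·(1+x). -/
noncomputable def Gfun (σ₁ σ₂ r x : ℝ) : ℝ :=
  deriv (psi σ₁ σ₂ r) x * (1 + x)^2 - 2 * psi σ₁ σ₂ r x * (1 + x)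

theorem hasDerivAt_exp_add_exp_neg (a b l x : ℝ) :
    HasDerivAt (fun y => a * Real.exp (l * y) + b * Real.exp (-l * y))
      (l * (a * Real.exp (l * x) - b * Real.exp (-l * x))) x := by
  have h (c : ℝ) : HasDerivAt (fun y => Real.exp (c * y)) (Real.exp (c * x) * c) x := by
    simpa using ((hasDerivAt_id x).const_mul c).exp
  exact (((h l).const_mul a).add ((h (-l)).const_mul b)).congr_deriv (by ring)

/-- If `f` is locally a combination of `exp (l * y)` and `exp (-l * y)`, then
`f' (1 + y)² - 2 f (1 + y)` has derivative `f (l² (1 + y)² - 2)`. -/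
theorem hasDerivAt_deriv_mul_sq_sub {f : ℝ → ℝ} {a b l x : ℝ}
    (hf : f =ᶠ[nhds x] fun y => a * Real.exp (l * y) + b * Real.exp (-l * y)) :
    HasDerivAt (fun y => deriv f y * (1 + y) ^ 2 - 2 * f y * (1 + y))
      (f x * (l ^ 2 * (1 + x) ^ 2 - 2)) x := by
  have hderiv : deriv f =ᶠ[nhds x]
      fun y => l * (a * Real.exp (l * y) - b * Real.exp (-l * y)) :=
    hf.deriv.trans (.of_forall fun y => (hasDerivAt_exp_add_exp_neg a b l y).deriv)
  have h₁ : HasDerivAt f (deriv f x) x :=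
    (((hasDerivAt_exp_add_exp_neg a b l x).congr_of_eventuallyEq hf).differentiableAt).hasDerivAt
  have h₂ : HasDerivAt (deriv f) (l ^ 2 * f x) x := by
    have hx : f x = a * Real.exp (l * x) + b * Real.exp (-l * x) := hf.eq_of_nhds
    rw [hx]
    refine (((hasDerivAt_exp_add_exp_neg a (-b) l x).const_mul l).congr_of_eventuallyEq
      (hderiv.trans (.of_forall fun y => ?_))).congr_deriv ?_ <;> ring
  have h₃ : HasDerivAt (fun y : ℝ => 1 + y) 1 x := (hasDerivAt_id x).const_add 1
  refine ((h₂.mul (h₃.pow 2)).sub ((h₁.const_mul 2).mul h₃)).congr_deriv ?_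
  simp only [Pi.pow_apply]
  push_cast
  ring

/-- For x > −1, x ≠ 0, G is differentiable at x with
G′(x) = (2/σ(x)²)·ψ(x)·(r(1+x)² − σ(x)²), with σ(x)=σ₁ for x<0, σ(x)=σ₂ for x>0. -/
theorem stmt_7 (σ₁ σ₂ r : ℝ) (hσ₁ : 0 < σ₁) (hσ₂ : 0 < σ₂) (hr : 0 < r) :
    ∀ x : ℝ, -1 < x → x ≠ 0 →
      HasDerivAt (Gfun σ₁ σ₂ r)
        (2/(if x < 0 then σ₁ else σ₂)^2 * psi σ₁ σ₂ r x *
          (r * (1 + x)^2 - (if x < 0 then σ₁ else σ₂)^2)) x := by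
  intro x _ hx
  have hsqrt : Real.sqrt (2 * r) ^ 2 = 2 * r := Real.sq_sqrt (by positivity)
  rcases hx.lt_or_gt with hx | hx
  · have hf : psi σ₁ σ₂ r =ᶠ[nhds x] fun y => 1 * Real.exp (Real.sqrt (2 * r) / σ₁ * y) +
        0 * Real.exp (-(Real.sqrt (2 * r) / σ₁) * y) := by
      filter_upwards [Iio_mem_nhds hx] with y hy
      simp [psi, Set.mem_Iio.mp hy]
    refine (hasDerivAt_deriv_mul_sq_sub hf).congr_deriv ?_
    rw [if_pos hx, div_pow, hsqrt]
    field_simp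
  · have hf : psi σ₁ σ₂ r =ᶠ[nhds x]
        fun y => (1 + σ₂ / σ₁) / 2 * Real.exp (Real.sqrt (2 * r) / σ₂ * y) +
          (1 - σ₂ / σ₁) / 2 * Real.exp (-(Real.sqrt (2 * r) / σ₂) * y) := by
      filter_upwards [Ioi_mem_nhds hx] with y hy
      simp [psi, (Set.mem_Ioi.mp hy).not_gt]
    refine (hasDerivAt_deriv_mul_sq_sub hf).congr_deriv ?_
    rw [if_neg hx.not_gt, div_pow, hsqrt]
    field_simp
end

section
/- Assume 0 < r ≤ σ₁² ≤ σ₂², and let c be the unique zero of G in (−1, ∞). Define G₊ : ℝ → ℝ by G₊(x) = 2·φ(x)·(1+x) − φ′(x)·(1+x)². Then G₊ is strictly decreasing on (c, ∞), G₊(x) → 0 as x → +∞, and consequently G₊(x) > 0 for every x ≥ c. -/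
open Real Filter Set

/-- The decreasing fundamental solution φ for the oscillating Brownian motion with
volatility `σ₁` on `(-∞,0)` and `σ₂` on `(0,∞)`, discount parameter `r`. -/
noncomputable def phi (σ₁ σ₂ r x : ℝ) : ℝ :=
  if x < 0 then (1 + σ₁/σ₂)/2 * Real.exp (-(Real.sqrt (2*r)/σ₁) * x)
       + (1 - σ₁/σ₂)/2 * Real.exp (Real.sqrt (2*r)/σ₁ * x)
  else Real.exp (-(Real.sqrt (2*r)/σ₂) * x)

/-- The function `t ↦ exp (2t) (2 - t) / (2 + t)` is strictly increasing on `[0, √2]`. -/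
lemma strictMonoOn_exp_mul_div :
    StrictMonoOn (fun t : ℝ => exp (2 * t) * (2 - t) / (2 + t)) (Icc 0 (√2)) := by
  have hd : ∀ t : ℝ, 0 ≤ t → HasDerivAt (fun t : ℝ => exp (2 * t) * (2 - t) / (2 + t))
      (exp (2 * t) * (4 - 2 * t ^ 2) / (2 + t) ^ 2) t := by
    intro t ht
    have h1 : HasDerivAt (fun t : ℝ => exp (2 * t)) (exp (2 * t) * (2 * 1)) t :=
      ((hasDerivAt_id t).const_mul 2).exp
    have hne : (2 + t) ≠ 0 := by positivity
    refine ((h1.mul ((hasDerivAt_id t).const_sub 2)).div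
      ((hasDerivAt_id t).const_add 2) hne).congr_deriv ?_
    simp only [id, Pi.mul_apply]
    field_simp
    ring
  refine strictMonoOn_of_deriv_pos (convex_Icc _ _)
    (fun t ht => (hd t ht.1).continuousAt.continuousWithinAt) fun t ht => ?_
  rw [interior_Icc] at ht
  rw [(hd t ht.1.le).deriv]
  have ht2 : t ^ 2 < 2 := (Real.lt_sqrt ht.1.le).1 ht.2
  have h0 := ht.1
  have : 0 < 4 - 2 * t ^ 2 := by linarith
  positivity

/-- A solution `w = l + y`, `y ≥ 0`, of `w / 2 = tanh (y + artanh s)`, written without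
hyperbolic functions, satisfies `√2 ≤ w` whenever `l < 2 s`. -/
lemma sqrt_two_le_of_exp_eq {s l w : ℝ} (hs : 0 < s) (hl : l < 2 * s) (hw : l ≤ w)
    (h : (1 + s) * exp (2 * (w - l)) * (2 - w) = (1 - s) * (2 + w)) : √2 ≤ w := by
  by_contra! hlt
  have hw2 : w < 2 := hlt.trans (by rw [Real.sqrt_lt' two_pos]; norm_num)
  have h2s : 2 * s ≤ w := by
    have h1 : 1 ≤ exp (2 * (w - l)) := Real.one_le_exp (by linarith)
    have h2 : 0 ≤ (1 + s) * (2 - w) := mul_nonneg (by linarith) (by linarith)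
    nlinarith
  have hmono : exp (2 * (2 * s)) * (2 - 2 * s) / (2 + 2 * s)
      ≤ exp (2 * w) * (2 - w) / (2 + w) := strictMonoOn_exp_mul_div.monotoneOn (a := 2 * s) (b := w)
    ⟨by linarith, by linarith⟩ ⟨by linarith, hlt.le⟩ h2s
  have hs1 : s < 1 := by linarith
  have hwv : exp (2 * w) * (2 - w) / (2 + w) = exp (2 * l) * (1 - s) / (1 + s) := by
    rw [div_eq_div_iff (by linarith) (by linarith)]
    have : exp (2 * w) = exp (2 * (w - l)) * exp (2 * l) := by
      rw [← Real.exp_add]; ring_nf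
    rw [this]
    linear_combination exp (2 * l) * h
  have hsv : exp (2 * (2 * s)) * (2 - 2 * s) / (2 + 2 * s)
      = exp (2 * (2 * s)) * (1 - s) / (1 + s) := by
    rw [div_eq_div_iff (by linarith) (by linarith)]
    ring
  rw [hwv, hsv] at hmono
  have hexp : exp (2 * l) < exp (2 * (2 * s)) := Real.exp_lt_exp.2 (by linarith)
  have hlt' : exp (2 * l) * (1 - s) / (1 + s) < exp (2 * (2 * s)) * (1 - s) / (1 + s) := by
    gcongr
  linarith

lemma hasDerivAt_exp_mul (a x : ℝ) :
    HasDerivAt (fun y => exp (a * y)) (a * exp (a * x)) x := by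
  simpa [mul_comm] using ((hasDerivAt_id x).const_mul a).exp

/-- `Gfun` has no zero in `(-1, 0]` when `√(2r) / σ₁ < 2`. -/
lemma pos_of_Gfun_eq_zero {σ₁ σ₂ r c : ℝ}
    (hl : √(2 * r) / σ₁ < 2) (hc : -1 < c) (hc0 : Gfun σ₁ σ₂ r c = 0) : 0 < c := by
  by_contra! hc'
  have heq : ∀ x ≤ 0, psi σ₁ σ₂ r x = exp (√(2 * r) / σ₁ * x) := by
    intro x hx
    rcases hx.lt_or_eq with hx | rfl
    · simp [psi, hx]
    · simp only [psi, lt_irrefl, if_false, mul_zero, exp_zero]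
      ring
  have hd : deriv (psi σ₁ σ₂ r) c < 2 * psi σ₁ σ₂ r c := by
    rw [heq c hc']
    by_cases hdiff : DifferentiableAt ℝ (psi σ₁ σ₂ r) c
    · have h1 : HasDerivWithinAt (psi σ₁ σ₂ r)
          (√(2 * r) / σ₁ * exp (√(2 * r) / σ₁ * c)) (Iic c) c :=
        (hasDerivAt_exp_mul _ c).hasDerivWithinAt.congr
          (fun x hx => heq x (le_trans hx hc')) (heq c hc')
      rw [(uniqueDiffOn_Iic c c self_mem_Iic).eq_deriv _ hdiff.hasDerivAt.hasDerivWithinAt h1]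
      gcongr
    · rw [deriv_zero_of_not_differentiableAt hdiff]
      positivity
  have hpsi : 0 < psi σ₁ σ₂ r c := by rw [heq c hc']; positivity
  have hfac : (1 + c) * (deriv (psi σ₁ σ₂ r) c * (1 + c) - 2 * psi σ₁ σ₂ r c) = 0 := by
    rw [← hc0, Gfun]; ring
  rcases mul_eq_zero.1 hfac with h | h
  · linarith
  · have : 2 * psi σ₁ σ₂ r c * (1 + c) ≤ 2 * psi σ₁ σ₂ r c :=
      mul_le_of_le_one_right (by positivity) (by linarith)
    nlinarith [mul_lt_mul_of_pos_right hd (by linarith : 0 < 1 + c)]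

lemma deriv_psi_of_pos {σ₁ σ₂ r x : ℝ} (hx : 0 < x) :
    deriv (psi σ₁ σ₂ r) x = √(2 * r) / σ₂ * ((1 + σ₂ / σ₁) / 2 * exp (√(2 * r) / σ₂ * x)
      - (1 - σ₂ / σ₁) / 2 * exp (-(√(2 * r) / σ₂) * x)) := by
  have he : psi σ₁ σ₂ r =ᶠ[nhds x] fun x => (1 + σ₂ / σ₁) / 2 * exp (√(2 * r) / σ₂ * x)
      + (1 - σ₂ / σ₁) / 2 * exp (-(√(2 * r) / σ₂) * x) := by
    filter_upwards [lt_mem_nhds hx] with y hy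
    simp [psi, hy.le.not_gt]
  rw [he.deriv_eq]
  refine (((hasDerivAt_exp_mul _ x).const_mul _).add
    ((hasDerivAt_exp_mul _ x).const_mul _)).deriv.trans ?_
  ring

lemma deriv_phi_of_pos {σ₁ σ₂ r x : ℝ} (hx : 0 < x) :
    deriv (phi σ₁ σ₂ r) x = -(√(2 * r) / σ₂) * exp (-(√(2 * r) / σ₂) * x) := by
  have he : phi σ₁ σ₂ r =ᶠ[nhds x] fun x => exp (-(√(2 * r) / σ₂) * x) := by
    filter_upwards [lt_mem_nhds hx] with y hy
    simp [phi, hy.le.not_gt]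
  rw [he.deriv_eq, (hasDerivAt_exp_mul _ x).deriv]

lemma sqrt_two_le_of_Gfun_eq_zero {σ₁ σ₂ r c : ℝ} (hσ₁ : 0 < σ₁) (hσ₂ : 0 < σ₂)
    (hl : √(2 * r) / σ₁ < 2) (hc : 0 < c) (hc0 : Gfun σ₁ σ₂ r c = 0) :
    √2 ≤ √(2 * r) / σ₂ * (1 + c) := by
  have hl2 : √(2 * r) / σ₂ < 2 * (σ₁ / σ₂) := by
    rw [div_lt_iff₀ hσ₁] at hl
    rw [← mul_div_assoc]
    gcongr
  have hl0 : 0 ≤ √(2 * r) / σ₂ := by positivity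
  rw [Gfun, deriv_psi_of_pos hc, psi, if_neg hc.le.not_gt] at hc0
  set l := √(2 * r) / σ₂
  refine sqrt_two_le_of_exp_eq (div_pos hσ₁ hσ₂) hl2 (by nlinarith) ?_
  have hE : exp (2 * (l * (1 + c) - l)) = exp (l * c) * exp (l * c) := by
    rw [← Real.exp_add]; ring_nf
  have hEE : exp (l * c) * exp (-l * c) = 1 := by
    rw [← Real.exp_add]; simp
  rw [hE]
  have hne : 1 + c ≠ 0 := by positivity
  set E := exp (l * c)
  set E' := exp (-l * c)
  have h : l * (1 + c) * ((σ₁ + σ₂) * E - (σ₁ - σ₂) * E')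
      = 2 * ((σ₁ + σ₂) * E + (σ₁ - σ₂) * E') := by
    have hfac : (1 + c) * (l * (1 + c) * ((σ₁ + σ₂) * E - (σ₁ - σ₂) * E')
      - 2 * ((σ₁ + σ₂) * E + (σ₁ - σ₂) * E')) = 0 := by
      field_simp at hc0
      linear_combination hc0
    linarith [(mul_eq_zero.1 hfac).resolve_left hne]
  field_simp
  linear_combination (-E) * h - (σ₁ - σ₂) * (l * (1 + c) + 2) * hEE

lemma strictAntiOn_exp_mul {l c : ℝ} (hl : 0 < l)
    (h : √2 ≤ l * (1 + c)) :
    StrictAntiOn (fun x => exp (-l * x) * (2 * (1 + x) + l * (1 + x) ^ 2)) (Ici c) := by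
  have hd : ∀ x, HasDerivAt (fun x => exp (-l * x) * (2 * (1 + x) + l * (1 + x) ^ 2))
      (exp (-l * x) * (2 - (l * (1 + x)) ^ 2)) x := by
    intro x
    have h1 : HasDerivAt (fun x : ℝ => 1 + x) 1 x := (hasDerivAt_id x).const_add 1
    refine ((hasDerivAt_exp_mul (-l) x).mul
      ((h1.const_mul 2).add ((h1.pow 2).const_mul l))).congr_deriv ?_
    simp only [Pi.add_apply, Pi.pow_apply]
    push_cast
    ring
  refine strictAntiOn_of_deriv_neg (convex_Ici c)
    (fun x _ => (hd x).continuousAt.continuousWithinAt) fun x hx => ?_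
  rw [interior_Ici] at hx
  rw [(hd x).deriv]
  have hlt : √2 < l * (1 + x) := h.trans_lt (by have : c < x := hx; gcongr)
  have : 2 < (l * (1 + x)) ^ 2 := (Real.sqrt_lt' ((Real.sqrt_nonneg 2).trans_lt hlt)).1 hlt
  exact mul_neg_of_pos_of_neg (exp_pos _) (by linarith)

lemma tendsto_exp_mul {l : ℝ} (hl : 0 < l) :
    Tendsto (fun x => exp (-l * x) * (2 * (1 + x) + l * (1 + x) ^ 2)) atTop (nhds 0) := by
  have hu : Tendsto (fun x : ℝ => l * (1 + x)) atTop atTop :=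
    (tendsto_atTop_add_const_left _ 1 tendsto_id).const_mul_atTop hl
  have h := ((((tendsto_pow_mul_exp_neg_atTop_nhds_zero 1).comp hu).const_mul 2).add
    ((tendsto_pow_mul_exp_neg_atTop_nhds_zero 2).comp hu)).const_mul (exp l / l)
  simp only [mul_zero, add_zero] at h
  refine h.congr fun x => ?_
  have he : exp (-l * x) = exp l * exp (-(l * (1 + x))) := by
    rw [← Real.exp_add]; ring_nf
  simp only [Function.comp_apply, he]
  field_simp

/-- Assume 0 < r ≤ σ₁² ≤ σ₂² and let c be the unique zero of G in (−1,∞). Then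
G₊(x) = 2·φ(x)·(1+x) − φ′(x)·(1+x)² is strictly decreasing on (c,∞), tends to 0
at +∞, and is strictly positive on [c,∞). -/
theorem stmt_10 (σ₁ σ₂ r : ℝ) (hσ₁ : 0 < σ₁) (hσ₂ : 0 < σ₂) (hr : 0 < r)
    (hr1 : r ≤ σ₁^2) (h12 : σ₁^2 ≤ σ₂^2)
    (c : ℝ) (hc : -1 < c) (hc0 : Gfun σ₁ σ₂ r c = 0)
    (huniq : ∀ y : ℝ, -1 < y → Gfun σ₁ σ₂ r y = 0 → y = c) :
    StrictAntiOn
      (fun x => 2 * phi σ₁ σ₂ r x * (1 + x) - deriv (phi σ₁ σ₂ r) x * (1 + x)^2)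
      (Set.Ioi c) ∧
    Tendsto
      (fun x => 2 * phi σ₁ σ₂ r x * (1 + x) - deriv (phi σ₁ σ₂ r) x * (1 + x)^2)
      atTop (nhds 0) ∧
    (∀ x : ℝ, c ≤ x →
      0 < 2 * phi σ₁ σ₂ r x * (1 + x) - deriv (phi σ₁ σ₂ r) x * (1 + x)^2) := by
  have hl1 : √(2 * r) / σ₁ < 2 := by
    rw [div_lt_iff₀ hσ₁, Real.sqrt_lt' (by positivity)]
    nlinarith
  have hl : 0 < √(2 * r) / σ₂ := by positivity
  have hcpos := pos_of_Gfun_eq_zero hl1 hc hc0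
  have hanti := strictAntiOn_exp_mul hl
    (sqrt_two_le_of_Gfun_eq_zero hσ₁ hσ₂ hl1 hcpos hc0)
  have heq : ∀ x, 0 < x → exp (-(√(2 * r) / σ₂) * x)
      * (2 * (1 + x) + √(2 * r) / σ₂ * (1 + x) ^ 2)
      = 2 * phi σ₁ σ₂ r x * (1 + x) - deriv (phi σ₁ σ₂ r) x * (1 + x) ^ 2 := by
    intro x hx
    rw [deriv_phi_of_pos hx, phi, if_neg hx.le.not_gt]
    ring
  refine ⟨(hanti.mono Ioi_subset_Ici_self).congr fun x hx => heq x (hcpos.trans hx),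
    (tendsto_exp_mul hl).congr' ?_, fun x hx => ?_⟩
  · filter_upwards [eventually_gt_atTop 0] with x hx using heq x hx
  · have hx0 : 0 < x := hcpos.trans_le hx
    rw [← heq x hx0]
    positivity
end

section
/- Assume 0 < 2σ₁² < σ₂² and 0 < r < 2σ₁². Then G has exactly one zero ρ in (−1, ∞), and ρ > σ₂/√r − 1 > 0. If instead r = 2σ₁², then G has exactly two zeros in (−1, ∞): the point 0 and a point ρ₂ with ρ₂ > σ₂/(√2·σ₁) − 1 > 0. -/
open Real Filter Set

open scoped Topology

/-- The combination `a e^{lx} + b e^{-lx}` of exponentials. -/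
noncomputable def expComb (l a b x : ℝ) : ℝ :=
  a * Real.exp (l * x) + b * Real.exp (-l * x)

theorem hasDerivAt_expComb (l a b x : ℝ) :
    HasDerivAt (expComb l a b) (l * expComb l a (-b) x) x := by
  have h (c : ℝ) : HasDerivAt (fun y : ℝ => Real.exp (c * y)) (Real.exp (c * x) * c) x := by
    simpa using ((hasDerivAt_id x).const_mul c).exp
  refine (((h l).const_mul a).add ((h (-l)).const_mul b)).congr_deriv ?_
  unfold expComb
  ring

theorem expComb_pos {l a b x : ℝ} (hl : 0 < l) (hb : b < 0) (hab : 0 < a + b) (hx : 0 ≤ x) :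
    0 < expComb l a b x := by
  have h₁ : 1 ≤ Real.exp (l * x) := Real.one_le_exp (by positivity)
  have h₂ : Real.exp (-l * x) ≤ 1 := Real.exp_le_one_iff.2 (by nlinarith)
  unfold expComb
  nlinarith

/-- A strictly convex differentiable function on `[0, ∞)` which is negative at, or immediately
to the right of, the origin and somewhere nonnegative has exactly one positive zero, at which its
derivative is positive. -/
theorem StrictConvexOn.exists_unique_pos_zero {f f' : ℝ → ℝ} {b : ℝ}
    (hf : StrictConvexOn ℝ (Ici 0) f) (hd : ∀ x, HasDerivAt f (f' x) x) (h₀ : f 0 ≤ 0)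
    (h₀' : f 0 = 0 → f' 0 < 0) (hb : 0 < b) (hfb : 0 ≤ f b) :
    ∃ ρ, 0 < ρ ∧ f ρ = 0 ∧ 0 < f' ρ ∧ ∀ y, 0 < y → f y = 0 → y = ρ := by
  have neg_of_lt {c d : ℝ} (hc : 0 < c) (hcd : c < d) (hfd : f d = 0) : f c < 0 := by
    have hseg : c ∈ openSegment ℝ 0 d := by
      rw [openSegment_eq_Ioo (hc.trans hcd)]
      exact ⟨hc, hcd⟩
    have := hf.lt_on_openSegment self_mem_Ici (hc.trans hcd).le (hc.trans hcd).ne hseg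
    rwa [hfd, max_eq_right h₀] at this
  obtain ⟨a, ha, hab, hfa⟩ : ∃ a, 0 ≤ a ∧ a < b ∧ f a < 0 := by
    rcases h₀.lt_or_eq with h | h
    · exact ⟨0, le_rfl, hb, h⟩
    · have hs : ∀ᶠ x in 𝓝[>] (0 : ℝ), slope f 0 x < 0 :=
        ((hasDerivWithinAt_iff_tendsto_slope' self_notMem_Ioi).1
          (hd 0).hasDerivWithinAt).eventually_lt_const (h₀' h)
      obtain ⟨a, hsa, ha, hab⟩ := (hs.and (Ioo_mem_nhdsGT hb)).exists
      refine ⟨a, ha.le, hab, ?_⟩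
      rw [slope_def_field, h, sub_zero, sub_zero] at hsa
      exact (div_neg_iff.1 hsa).elim (fun h' => absurd h'.2 ha.not_gt) And.left
  have hcont : ContinuousOn f (Icc a b) := fun x _ => (hd x).continuousAt.continuousWithinAt
  obtain ⟨ρ, ⟨haρ, -⟩, hρ⟩ := intermediate_value_Icc hab.le hcont ⟨hfa.le, hfb⟩
  have hρ₀ : 0 < ρ := ha.trans_lt (haρ.lt_of_ne fun h => hfa.ne (h ▸ hρ))
  refine ⟨ρ, hρ₀, hρ, ?_, fun y hy hfy => ?_⟩
  · refine lt_of_le_of_lt ?_ (hf.slope_lt_of_hasDerivAt self_mem_Ici hρ₀.le hρ₀ (hd ρ))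
    rw [slope_def_field, hρ]
    exact div_nonneg (by linarith) (by linarith)
  · rcases lt_trichotomy y ρ with h | h | h
    · exact absurd hfy (neg_of_lt hy h hρ).ne
    · exact h
    · exact absurd hρ (neg_of_lt hρ₀ h hfy).ne

/-- The function `(1 + x) P′(x) - 2 P(x)` for `P = expComb l a b`. -/
noncomputable def tangency (l a b x : ℝ) : ℝ :=
  l * expComb l a (-b) x * (1 + x) - 2 * expComb l a b x

theorem hasDerivAt_tangency (l a b x : ℝ) :
    HasDerivAt (tangency l a b)
      (l ^ 2 * expComb l a b x * (1 + x) - l * expComb l a (-b) x) x := by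
  refine ((((hasDerivAt_expComb l a (-b) x).const_mul l).mul
    ((hasDerivAt_id x).const_add 1)).sub ((hasDerivAt_expComb l a b x).const_mul 2)).congr_deriv ?_
  simp only [neg_neg, id]
  ring

theorem strictConvexOn_tangency {l a b : ℝ} (hl : 0 < l) (ha : 0 < a) (hb : b < 0) :
    StrictConvexOn ℝ (Ici 0) (tangency l a b) := by
  refine strictConvexOn_of_deriv2_pos' (convex_Ici 0)
    (fun x _ => (hasDerivAt_tangency l a b x).continuousAt.continuousWithinAt) fun x hx => ?_
  have hderiv : deriv (tangency l a b) =
      fun x => l ^ 2 * expComb l a b x * (1 + x) - l * expComb l a (-b) x :=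
    funext fun x => (hasDerivAt_tangency l a b x).deriv
  have h₂ : HasDerivAt (fun x => l ^ 2 * expComb l a b x * (1 + x) - l * expComb l a (-b) x)
      (l ^ 3 * expComb l a (-b) x * (1 + x)) x := by
    refine ((((hasDerivAt_expComb l a b x).const_mul (l ^ 2)).mul
      ((hasDerivAt_id x).const_add 1)).sub
        ((hasDerivAt_expComb l a (-b) x).const_mul l)).congr_deriv ?_
    simp only [neg_neg, id]
    ring
  rw [Function.iterate_succ_apply, Function.iterate_one, hderiv, h₂.deriv]
  have hx' : (0 : ℝ) ≤ x := hx
  have hb' : 0 < -b := neg_pos.2 hb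
  unfold expComb
  positivity

theorem exists_unique_pos_zero_tangency {l a b : ℝ} (hl : 0 < l) (ha : 0 < a) (hb : b < 0)
    (hab : 0 < a + b) (h₀ : tangency l a b 0 ≤ 0)
    (h₀' : tangency l a b 0 = 0 → l ^ 2 * (a + b) < l * (a - b)) :
    ∃ ρ, 0 < ρ ∧ tangency l a b ρ = 0 ∧ 2 < (l * (1 + ρ)) ^ 2 ∧
      ∀ y, 0 < y → tangency l a b y = 0 → y = ρ := by
  have hb' : 0 < -b := neg_pos.2 hb
  have hlarge : 0 ≤ tangency l a b (2 / l) := by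
    have h : tangency l a b (2 / l) =
        l * a * Real.exp (l * (2 / l)) + (l + 4) * (-b) * Real.exp (-l * (2 / l)) := by
      unfold tangency expComb
      field_simp
      ring
    rw [h]
    positivity
  obtain ⟨ρ, hρ, hz, hd, huniq⟩ :=
    (strictConvexOn_tangency hl ha hb).exists_unique_pos_zero (hasDerivAt_tangency l a b) h₀
      (fun h => by
        have := h₀' h
        simp only [expComb, mul_zero, Real.exp_zero]
        linarith) (by positivity) hlarge
  refine ⟨ρ, hρ, hz, ?_, huniq⟩
  have hP := expComb_pos hl hb hab hρ.le
  have hu : 0 < 1 + ρ := by linarith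
  have hmul := mul_pos hd hu
  unfold tangency at hz
  have hprod : 0 < expComb l a b ρ * ((l * (1 + ρ)) ^ 2 - 2) := by linarith
  linarith [(pos_iff_pos_of_mul_pos hprod).1 hP]

theorem Gfun_of_neg {σ₁ σ₂ r x : ℝ} (hx : x < 0) :
    Gfun σ₁ σ₂ r x = Real.exp (√(2 * r) / σ₁ * x) * (1 + x) * (√(2 * r) / σ₁ * (1 + x) - 2) := by
  have heq : psi σ₁ σ₂ r =ᶠ[𝓝 x] fun y => Real.exp (√(2 * r) / σ₁ * y) := by
    filter_upwards [Iio_mem_nhds hx] with y hy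
    exact if_pos hy
  have hd : HasDerivAt (fun y : ℝ => Real.exp (√(2 * r) / σ₁ * y))
      (Real.exp (√(2 * r) / σ₁ * x) * (√(2 * r) / σ₁)) x := by
    simpa using ((hasDerivAt_id x).const_mul (√(2 * r) / σ₁)).exp
  rw [Gfun, heq.deriv_eq, heq.self_of_nhds, hd.deriv]
  ring

theorem Gfun_of_nonneg {σ₁ σ₂ r x : ℝ} (hσ₁ : 0 < σ₁) (hσ₂ : 0 < σ₂) (hx : 0 ≤ x) :
    Gfun σ₁ σ₂ r x =
      tangency (√(2 * r) / σ₂) ((1 + σ₂ / σ₁) / 2) ((1 - σ₂ / σ₁) / 2) x * (1 + x) := by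
  set l := √(2 * r) / σ₂ with hl
  set a := (1 + σ₂ / σ₁) / 2 with ha
  set b := (1 - σ₂ / σ₁) / 2 with hb
  have hval {y : ℝ} (hy : 0 ≤ y) : psi σ₁ σ₂ r y = expComb l a b y := if_neg hy.not_gt
  have hright : HasDerivWithinAt (psi σ₁ σ₂ r) (l * expComb l a (-b) x) (Ici 0) x :=
    (hasDerivAt_expComb l a b x).hasDerivWithinAt.congr (fun y hy => hval hy) (hval hx)
  have hd : HasDerivAt (psi σ₁ σ₂ r) (l * expComb l a (-b) x) x := by
    rcases hx.eq_or_lt with rfl | hx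
    · have hexp : HasDerivAt (fun y : ℝ => Real.exp (√(2 * r) / σ₁ * y)) (√(2 * r) / σ₁) 0 := by
        simpa using ((hasDerivAt_id (0 : ℝ)).const_mul (√(2 * r) / σ₁)).exp
      have hneg : ∀ y ∈ Iio (0 : ℝ), psi σ₁ σ₂ r y = Real.exp (√(2 * r) / σ₁ * y) :=
        fun y hy => if_pos hy
      have hleft : HasDerivWithinAt (psi σ₁ σ₂ r) (l * expComb l a (-b) 0) (Iio 0) 0 := by
        refine (hexp.hasDerivWithinAt.congr hneg ?_).congr_deriv ?_
        · rw [hval le_rfl]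
          simp only [expComb, mul_zero, Real.exp_zero, ha, hb]
          ring
        · simp only [expComb, mul_zero, Real.exp_zero, ha, hb, hl]
          field_simp
          ring
      simpa [Iio_union_Ici] using hleft.union hright
    · exact hright.hasDerivAt (Ici_mem_nhds hx)
  rw [Gfun, hd.deriv, hval hx, tangency]
  ring

/-- If `r ≤ 2σ₁²`, then `Gfun` has exactly one positive zero, no zero in `(-1, 0)`, and vanishes
at the origin if and only if `r = 2σ₁²`. -/
theorem exists_unique_pos_zero_Gfun {σ₁ σ₂ r : ℝ} (hσ₁ : 0 < σ₁) (hσ₂ : 0 < σ₂)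
    (h12 : 2 * σ₁ ^ 2 < σ₂ ^ 2) (hr : 0 < r) (hr' : r ≤ 2 * σ₁ ^ 2) :
    (Gfun σ₁ σ₂ r 0 = 0 ↔ r = 2 * σ₁ ^ 2) ∧
    ∃ ρ, 0 < ρ ∧ σ₂ / √r - 1 < ρ ∧ 0 < σ₂ / √r - 1 ∧ Gfun σ₁ σ₂ r ρ = 0 ∧
      ∀ y, -1 < y → Gfun σ₁ σ₂ r y = 0 → y = 0 ∨ y = ρ := by
  have hsqrt : 0 < √(2 * r) := Real.sqrt_pos.2 (by positivity)
  have hsq : √(2 * r) ^ 2 = 2 * r := Real.sq_sqrt (by positivity)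
  have hlt : σ₁ < σ₂ := lt_of_pow_lt_pow_left₀ 2 hσ₂.le (by nlinarith [sq_nonneg σ₁])
  have hle : √(2 * r) ≤ 2 * σ₁ := (Real.sqrt_le_left (by positivity)).2 (by nlinarith)
  have hratio : 1 < σ₂ / σ₁ := (one_lt_div hσ₁).2 hlt
  have hzero : tangency (√(2 * r) / σ₂) ((1 + σ₂ / σ₁) / 2) ((1 - σ₂ / σ₁) / 2) 0 =
      √(2 * r) / σ₁ - 2 := by
    simp only [tangency, expComb, mul_zero, Real.exp_zero]
    field_simp
    ring
  have hslope : √(2 * r) / σ₁ ≤ 2 := (div_le_iff₀ hσ₁).2 hle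
  obtain ⟨ρ, hρ, hz, hbound, huniq⟩ := exists_unique_pos_zero_tangency
    (l := √(2 * r) / σ₂) (a := (1 + σ₂ / σ₁) / 2) (b := (1 - σ₂ / σ₁) / 2)
    (by positivity) (by positivity) (by linarith) (by linarith) (by linarith) (fun h => by
      have hs : √(2 * r) = 2 * σ₁ := by
        rw [hzero, sub_eq_zero, div_eq_iff hσ₁.ne'] at h
        exact h
      have h₁ : (√(2 * r) / σ₂) ^ 2 < 2 := by
        rw [hs, div_pow, div_lt_iff₀ (by positivity)]
        linarith
      have h₂ : √(2 * r) / σ₂ * (σ₂ / σ₁) = 2 := by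
        rw [hs]
        field_simp
      linarith)
  have hrσ : √r < σ₂ := (Real.sqrt_lt' hσ₂).2 (by linarith)
  have hr₀ : 0 < √r := Real.sqrt_pos.2 hr
  refine ⟨?_, ρ, hρ, ?_, sub_pos.2 ((one_lt_div hr₀).2 hrσ), ?_, fun y hy hGy => ?_⟩
  · rw [Gfun_of_nonneg hσ₁ hσ₂ le_rfl, hzero, add_zero, mul_one, sub_eq_zero,
      div_eq_iff hσ₁.ne']
    constructor
    · intro h
      rw [h] at hsq
      linarith
    · rintro rfl
      rw [show 2 * (2 * σ₁ ^ 2) = (2 * σ₁) ^ 2 by ring, Real.sqrt_sq (by positivity)]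
  · have hu : 0 < 1 + ρ := by linarith
    rw [sub_lt_iff_lt_add', div_lt_iff₀ hr₀]
    refine lt_of_pow_lt_pow_left₀ 2 (by positivity) ?_
    rw [mul_pow, Real.sq_sqrt hr.le]
    rw [mul_pow, div_pow, hsq, div_mul_eq_mul_div, lt_div_iff₀ (by positivity)] at hbound
    linarith
  · rw [Gfun_of_nonneg hσ₁ hσ₂ hρ.le, hz, zero_mul]
  · have hu : 0 < 1 + y := by linarith
    rcases lt_trichotomy y 0 with h | h | h
    · have hlt₂ : √(2 * r) / σ₁ * (1 + y) - 2 < 0 := by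
        have : 0 < √(2 * r) / σ₁ := by positivity
        nlinarith
      rw [Gfun_of_neg h] at hGy
      exact absurd hGy (mul_neg_of_pos_of_neg (by positivity) hlt₂).ne
    · exact Or.inl h
    · rw [Gfun_of_nonneg hσ₁ hσ₂ h.le] at hGy
      exact Or.inr (huniq y h ((mul_eq_zero.1 hGy).resolve_right hu.ne'))

/-- Assume 0 < 2σ₁² < σ₂². If 0 < r < 2σ₁² then G has exactly one zero ρ in
(−1,∞) and ρ > σ₂/√r − 1 > 0. If r = 2σ₁² then G has exactly two zeros in
(−1,∞): the point 0 and a point ρ₂ > σ₂/(√2·σ₁) − 1 > 0. -/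
theorem stmt_17 (σ₁ σ₂ r : ℝ) (hσ₁ : 0 < σ₁) (hσ₂ : 0 < σ₂)
    (h12 : 2*σ₁^2 < σ₂^2) (hr : 0 < r) :
    (r < 2*σ₁^2 →
      ∃ ρ : ℝ, σ₂/Real.sqrt r - 1 < ρ ∧ 0 < σ₂/Real.sqrt r - 1 ∧
        Gfun σ₁ σ₂ r ρ = 0 ∧
        ∀ y : ℝ, -1 < y → Gfun σ₁ σ₂ r y = 0 → y = ρ) ∧
    (r = 2*σ₁^2 →
      Gfun σ₁ σ₂ r 0 = 0 ∧
      ∃ ρ₂ : ℝ, σ₂/(Real.sqrt 2 * σ₁) - 1 < ρ₂ ∧ 0 < σ₂/(Real.sqrt 2 * σ₁) - 1 ∧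
        Gfun σ₁ σ₂ r ρ₂ = 0 ∧
        ∀ y : ℝ, -1 < y → Gfun σ₁ σ₂ r y = 0 → y = 0 ∨ y = ρ₂) := by
  refine ⟨fun h => ?_, fun h => ?_⟩
  · obtain ⟨h₀, ρ, -, hlt, hpos, hz, huniq⟩ :=
      exists_unique_pos_zero_Gfun hσ₁ hσ₂ h12 hr h.le
    refine ⟨ρ, hlt, hpos, hz, fun y hy hGy => (huniq y hy hGy).resolve_left ?_⟩
    rintro rfl
    exact h.ne (h₀.1 hGy)
  · obtain ⟨h₀, ρ, -, hlt, hpos, hz, huniq⟩ :=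
      exists_unique_pos_zero_Gfun hσ₁ hσ₂ h12 hr h.le
    have hs : √r = √2 * σ₁ := by
      rw [h, Real.sqrt_mul zero_le_two, Real.sqrt_sq hσ₁.le]
    rw [hs] at hlt hpos
    exact ⟨h₀.2 h, ρ, hlt, hpos, hz, huniq⟩
end
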